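/- Let n ≥ 1 and let S ⊆ ℕ^n × ℕ^n × ℕ be a set such that its projection {(β,k) : there exists α with (α,β,k) ∈ S} onto the last n+1 coordinates is finite. Then there exists a finite subset E ⊆ S such that convexHull(S) + W^⋆ = convexHull(E) + W^⋆ as subsets of ℝ^{2n+1}. -/

import Mathlib

open Pointwise

/-- Embedding of `ℕ^n × ℕ^n × ℕ` into `ℝ^n × ℝ^n × ℝ`. -/
def toR (n : ℕ) (γ : (Fin n → ℕ) × (Fin n → ℕ) × ℕ) :
    (Fin n → ℝ) × (Fin n → ℝ) × ℝ :=
  (fun i => (γ.1 i : ℝ), fun i => (γ.2.1 i : ℝ), (γ.2.2 : ℝ))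

/-- The cone `W^⋆ ⊆ ℝ^{2n+1}`, generated by the vectors `(e_i, 0)` and `(e'_i, 0)`,
where `e_i` is the `i`-th standard basis vector of `ℝ^{2n}` and `e'_i` has `-1` at
positions `i` and `n+i` and `0` elsewhere. -/
def Wstar (n : ℕ) : Set ((Fin n → ℝ) × (Fin n → ℝ) × ℝ) :=
  { p | ∃ a b : Fin n → ℝ, (∀ i, 0 ≤ a i) ∧ (∀ i, 0 ≤ b i) ∧
      p = ∑ i : Fin n,
        (a i • ((Pi.single i 1 : Fin n → ℝ), (0 : Fin n → ℝ), (0 : ℝ)) +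
         b i • (-(Pi.single i 1 : Fin n → ℝ), -(Pi.single i 1 : Fin n → ℝ), (0 : ℝ))) }

theorem mem_Wstar_iff (n : ℕ) (p : (Fin n → ℝ) × (Fin n → ℝ) × ℝ) :
    p ∈ Wstar n ↔ ∃ a b : Fin n → ℝ, 0 ≤ a ∧ 0 ≤ b ∧ p = (a - b, -b, 0) := by
  have key (a b : Fin n → ℝ) : ∑ i : Fin n,
      (a i • ((Pi.single i 1 : Fin n → ℝ), (0 : Fin n → ℝ), (0 : ℝ)) +
        b i • (-(Pi.single i 1 : Fin n → ℝ), -(Pi.single i 1 : Fin n → ℝ), (0 : ℝ))) =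
      (a - b, -b, 0) := by
    refine Prod.ext ?_ (Prod.ext ?_ ?_)
    · ext j
      simp [Prod.fst_sum, Finset.sum_add_distrib, Pi.single_apply, sub_eq_add_neg]
    · ext j
      simp [Prod.fst_sum, Prod.snd_sum, Pi.single_apply]
    · simp [Prod.snd_sum]
  simp only [Wstar, key, Set.mem_ofPred_eq, Pi.le_def, Pi.zero_apply]

theorem zero_mem_Wstar (n : ℕ) : 0 ∈ Wstar n :=
  (mem_Wstar_iff n 0).2 ⟨0, 0, le_rfl, le_rfl, by simp; rfl⟩

theorem add_mem_Wstar {n : ℕ} {p q : (Fin n → ℝ) × (Fin n → ℝ) × ℝ}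
    (hp : p ∈ Wstar n) (hq : q ∈ Wstar n) : p + q ∈ Wstar n := by
  rw [mem_Wstar_iff] at *
  obtain ⟨a, b, ha, hb, rfl⟩ := hp
  obtain ⟨c, d, hc, hd, rfl⟩ := hq
  refine ⟨a + c, b + d, add_nonneg ha hc, add_nonneg hb hd, ?_⟩
  ext <;> simp <;> ring

theorem smul_mem_Wstar {n : ℕ} {t : ℝ} (ht : 0 ≤ t) {p : (Fin n → ℝ) × (Fin n → ℝ) × ℝ}
    (hp : p ∈ Wstar n) : t • p ∈ Wstar n := by
  rw [mem_Wstar_iff] at *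
  obtain ⟨a, b, ha, hb, rfl⟩ := hp
  refine ⟨t • a, t • b, smul_nonneg ht ha, smul_nonneg ht hb, ?_⟩
  ext <;> simp
  ring

theorem convex_Wstar (n : ℕ) : Convex ℝ (Wstar n) :=
  fun _ hp _ hq _ _ hs ht _ => add_mem_Wstar (smul_mem_Wstar hs hp) (smul_mem_Wstar ht hq)

theorem Wstar_add_Wstar (n : ℕ) : Wstar n + Wstar n = Wstar n := by
  refine (Set.add_subset_iff.2 fun _ hp _ hq => add_mem_Wstar hp hq).antisymm ?_
  exact Set.subset_add_left _ (zero_mem_Wstar n)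

/-- Increasing the first block of coordinates moves a point by an element of the cone. -/
theorem toR_mem_add_Wstar {n : ℕ} {α α' β : Fin n → ℕ} {k : ℕ}
    {E : Set ((Fin n → ℕ) × (Fin n → ℕ) × ℕ)} (hE : (α, β, k) ∈ E) (h : α ≤ α') :
    toR n (α', β, k) ∈ toR n '' E + Wstar n := by
  refine Set.mem_add.2 ⟨_, Set.mem_image_of_mem _ hE,
    (fun i => (α' i : ℝ) - α i, 0, 0), ?_, ?_⟩
  · exact (mem_Wstar_iff n _).2 ⟨fun i => (α' i : ℝ) - α i, 0,
      fun i => sub_nonneg.2 (Nat.cast_le.2 (h i)), le_rfl, by simp⟩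
  · ext <;> simp [toR]

theorem convexHull_add_subset_of_subset_add {V : Type*} [AddCommGroup V] [Module ℝ V]
    {W X Y : Set V} (hW : Convex ℝ W) (hWW : W + W = W) (h : X ⊆ Y + W) :
    convexHull ℝ X + W ⊆ convexHull ℝ Y + W := by
  calc convexHull ℝ X + W ⊆ convexHull ℝ (Y + W) + W := by gcongr
    _ = convexHull ℝ Y + W := by rw [convexHull_add, hW.convexHull_eq, add_assoc, hWW]

/-- Finite generation of Newton polyhedra: if `S ⊆ ℕ^{2n+1}` has finite projection onto
the last `n+1` coordinates, then its Newton polyhedron is already attained by a finite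
subset `E ⊆ S`. -/
theorem newton_polyhedron_finitely_generated
    (n : ℕ) (hn : 1 ≤ n)
    (S : Set ((Fin n → ℕ) × (Fin n → ℕ) × ℕ))
    (hfin : {bk : (Fin n → ℕ) × ℕ | ∃ α : Fin n → ℕ, (α, bk.1, bk.2) ∈ S}.Finite) :
    ∃ E : Set ((Fin n → ℕ) × (Fin n → ℕ) × ℕ), E ⊆ S ∧ E.Finite ∧
      convexHull ℝ (toR n '' S) + Wstar n = convexHull ℝ (toR n '' E) + Wstar n := by
  let M (bk : (Fin n → ℕ) × ℕ) : Set (Fin n → ℕ) := {α | Minimal (fun α => (α, bk) ∈ S) α}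
  have hM (bk : (Fin n → ℕ) × ℕ) : (M bk).Finite :=
    WellQuasiOrderedLE.finite_of_isAntichain (setOfPred_minimal_antichain _)
  let E : Set ((Fin n → ℕ) × (Fin n → ℕ) × ℕ) := {γ | γ.1 ∈ M γ.2}
  have hES : E ⊆ S := fun γ hγ => Minimal.prop (P := fun α => (α, γ.2) ∈ S) hγ
  refine ⟨E, hES, ?_, ?_⟩
  · refine (hfin.biUnion fun bk _ => (hM bk).image fun α => (α, bk)).subset ?_
    exact fun γ hγ => Set.mem_biUnion (x := γ.2) ⟨γ.1, hES hγ⟩ ⟨γ.1, hγ, rfl⟩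
  · apply Set.Subset.antisymm
    · refine convexHull_add_subset_of_subset_add (convex_Wstar n) (Wstar_add_Wstar n) ?_
      rintro _ ⟨⟨α, β, k⟩, hS, rfl⟩
      obtain ⟨α₀, hle, hmin⟩ :=
        (Set.isPWO_of_wellQuasiOrderedLE {α | (α, β, k) ∈ S}).exists_le_minimal hS
      exact toR_mem_add_Wstar (E := E) (α := α₀) hmin hle
    · gcongr
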